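/- Let H be a strictly 2-balanced graph with 1 < m_2(H) < δ(H)(δ(H)+1)/(2δ(H)+1), where δ(H) denotes the minimum degree of H. Then there exists a constant c > 0 such that if p = p(n) ≤ c·n^{-1/m_2(H)}, the probability that G(n,p) has the anti-Ramsey property for H tends to 0 as n → ∞. -/

import Mathlib

open SimpleGraph Filter

/-- `f` is the vertex map of a copy of `H` inside `G`. -/
def GraphCopy {V W : Type*} (H : SimpleGraph W) (G : SimpleGraph V) (f : W ↪ V) : Prop :=
  ∀ ⦃x y : W⦄, H.Adj x y → G.Adj (f x) (f y)

/-- The colouring `χ` admits a monochromatic copy of `H` in `G`. -/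
def HasMonoCopy {V W β : Type*} (H : SimpleGraph W) (G : SimpleGraph V)
    (χ : Sym2 V → β) : Prop :=
  ∃ f : W ↪ V, GraphCopy H G f ∧
    ∀ e ∈ H.edgeSet, ∀ e' ∈ H.edgeSet, χ (Sym2.map (⇑f) e) = χ (Sym2.map (⇑f) e')

/-- The colouring `χ` admits a rainbow copy of `H` in `G`. -/
def HasRainbowCopy {V W β : Type*} (H : SimpleGraph W) (G : SimpleGraph V)
    (χ : Sym2 V → β) : Prop :=
  ∃ f : W ↪ V, GraphCopy H G f ∧
    ∀ e ∈ H.edgeSet, ∀ e' ∈ H.edgeSet, e ≠ e' → χ (Sym2.map (⇑f) e) ≠ χ (Sym2.map (⇑f) e')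

/-- `G` has the constrained Ramsey property for `(H₁, H₂)`. -/
def ConstrainedRamsey {V W₁ W₂ : Type*} (G : SimpleGraph V)
    (H₁ : SimpleGraph W₁) (H₂ : SimpleGraph W₂) : Prop :=
  ∀ (β : Type) (χ : Sym2 V → β), HasMonoCopy H₁ G χ ∨ HasRainbowCopy H₂ G χ

/-- `χ` is a proper edge-colouring of `G`. -/
def ProperEdgeColoring {V β : Type*} (G : SimpleGraph V) (χ : Sym2 V → β) : Prop :=
  ∀ e ∈ G.edgeSet, ∀ e' ∈ G.edgeSet, e ≠ e' → (∃ v, v ∈ e ∧ v ∈ e') → χ e ≠ χ e'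

/-- `G` has the anti-Ramsey property for `H`. -/
def AntiRamsey {V W : Type*} (G : SimpleGraph V) (H : SimpleGraph W) : Prop :=
  ∀ (β : Type) (χ : Sym2 V → β), ProperEdgeColoring G χ → HasRainbowCopy H G χ

/-- The value `d₂` computed from the number of edges `e` and vertices `v`. -/
noncomputable def d2val (e v : ℕ) : ℝ :=
  if 1 ≤ e ∧ 3 ≤ v then ((e : ℝ) - 1) / ((v : ℝ) - 2)
  else if e = 1 ∧ v = 2 then 1 / 2
  else 0

/-- `m(G)`: the maximum of `e(J)/v(J)` over subgraphs `J` of `G` with at least one vertex. -/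
noncomputable def maxDensity {V : Type*} (G : SimpleGraph V) : ℝ :=
  sSup {x : ℝ | ∃ J : G.Subgraph, J.verts.Nonempty ∧
    x = (J.edgeSet.ncard : ℝ) / (J.verts.ncard : ℝ)}

/-- `m₂(G)`: the maximum of `d₂(J)` over subgraphs `J` of `G`. -/
noncomputable def twoDensity {V : Type*} (G : SimpleGraph V) : ℝ :=
  sSup {x : ℝ | ∃ J : G.Subgraph, x = d2val J.edgeSet.ncard J.verts.ncard}

/-- `G` is strictly 2-balanced. -/
def StrictlyTwoBalanced {V : Type*} (G : SimpleGraph V) : Prop :=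
  ∀ J : G.Subgraph, J ≠ ⊤ →
    d2val J.edgeSet.ncard J.verts.ncard < d2val G.edgeSet.ncard (Nat.card V)

/-- The star `K_{1,k}` with centre `0`. -/
def starGraph (k : ℕ) : SimpleGraph (Fin (k + 1)) :=
  SimpleGraph.fromRel (fun i _ => i = 0)

/-- The minimum degree `δ(G)`. -/
noncomputable def minDeg {V : Type*} (G : SimpleGraph V) : ℕ :=
  sInf {d : ℕ | ∃ v : V, d = (G.neighborSet v).ncard}

noncomputable instance (n : ℕ) : Fintype (SimpleGraph (Fin n)) :=
  Fintype.ofInjective (fun G : SimpleGraph (Fin n) => G.edgeSet)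
    fun _ _ h => SimpleGraph.edgeSet_inj.mp h

open Classical in
/-- The probability that `G(n,p)` satisfies the property `P`. -/
noncomputable def grProb (n : ℕ) (p : ℝ) (P : SimpleGraph (Fin n) → Prop) : ℝ :=
  ∑ G : SimpleGraph (Fin n),
    if P G then p ^ G.edgeSet.ncard * (1 - p) ^ (n.choose 2 - G.edgeSet.ncard) else 0

/-- `s` is the vertex set of a triangle of `T`. -/
def IsTriangleSet {V : Type*} (T : SimpleGraph V) (s : Set V) : Prop :=
  ∃ x y z : V, T.Adj x y ∧ T.Adj x z ∧ T.Adj y z ∧ s = {x, y, z}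

/-- `T` is triangle-connected. -/
def TriangleConnected {V : Type*} (T : SimpleGraph V) : Prop :=
  (∀ v : V, ∃ w, T.Adj v w) ∧
  (∀ u v : V, T.Adj u v → ∃ w, T.Adj u w ∧ T.Adj v w) ∧
  (∀ s t : Set V, IsTriangleSet T s → IsTriangleSet T t →
    Relation.ReflTransGen
      (fun x y : Set V => IsTriangleSet T x ∧ IsTriangleSet T y ∧ (x ∩ y).ncard = 2) s t)

/-- A triangle sequence `T₀, …, T_ℓ` in `T`, together with the chosen vertices `v i`
and base edges `a i`–`b i`. -/
structure TriangleSeq {V : Type*} (T : SimpleGraph V) (ℓ : ℕ) where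
  G : ℕ → T.Subgraph
  v : ℕ → V
  a : ℕ → V
  b : ℕ → V
  init : ∃ x y z : V, ∃ (hxy : T.Adj x y) (hxz : T.Adj x z) (hyz : T.Adj y z),
    G 0 = T.subgraphOfAdj hxy ⊔ T.subgraphOfAdj hxz ⊔ T.subgraphOfAdj hyz
  newVert : ∀ i, 1 ≤ i → i ≤ ℓ → v i ∉ (G (i - 1)).verts
  baseEdge : ∀ i, 1 ≤ i → i ≤ ℓ →
    (G (i - 1)).Adj (a i) (b i) ∧ T.Adj (v i) (a i) ∧ T.Adj (v i) (b i)
  vertsEq : ∀ i, 1 ≤ i → i ≤ ℓ → (G i).verts = (G (i - 1)).verts ∪ {v i}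
  adjEq : ∀ i, 1 ≤ i → i ≤ ℓ → ∀ x y : V, (G i).Adj x y ↔
    ((G (i - 1)).Adj x y ∨ (x = v i ∧ y ∈ (G (i - 1)).verts ∧ T.Adj x y)
      ∨ (y = v i ∧ x ∈ (G (i - 1)).verts ∧ T.Adj x y))

/-- `deg(v_i, T_{i-1})`: the number of neighbours of `v i` (in `T`) inside `T_{i-1}`. -/
noncomputable def TriangleSeq.deg {V : Type*} {T : SimpleGraph V} {ℓ : ℕ}
    (s : TriangleSeq T ℓ) (i : ℕ) : ℕ :=
  ((s.G (i - 1)).verts ∩ T.neighborSet (s.v i)).ncard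

/-- `r(T₀, …, T_ℓ) = Σ_{i ∈ [ℓ]} (deg(v_i, T_{i-1}) − 2)`. -/
noncomputable def TriangleSeq.r {V : Type*} {T : SimpleGraph V} {ℓ : ℕ}
    (s : TriangleSeq T ℓ) : ℤ :=
  ∑ i ∈ Finset.Icc 1 ℓ, ((s.deg i : ℤ) - 2)

/-- Step `i` is regular. -/
def TriangleSeq.Regular {V : Type*} {T : SimpleGraph V} {ℓ : ℕ}
    (s : TriangleSeq T ℓ) (i : ℕ) : Prop :=
  s.deg i = 2

/-- A `ρ`-minimal triangle sequence. -/
def RhoMinimal {V : Type*} {T : SimpleGraph V} {ℓ : ℕ} (ρ : ℕ)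
    (s : TriangleSeq T ℓ) : Prop :=
  (ρ : ℤ) ≤ s.r ∧ ∀ (ℓ' : ℕ) (s' : TriangleSeq T ℓ'), (ρ : ℤ) ≤ s'.r → ¬ s'.G ℓ' < s.G ℓ


section Deterministic

set_option linter.unusedSectionVars false
set_option linter.unusedDecidableInType false
set_option linter.unusedFintypeInType false

variable {V W : Type} [Fintype V] [Fintype W] [DecidableEq W]

/-- The image of the edge set of `H` under an injective vertex map. -/
noncomputable def copyEdges (H : SimpleGraph V) (h : V ↪ W) : Finset (Sym2 W) :=
  H.edgeSet.toFinite.toFinset.map ⟨Sym2.map h, Sym2.map.injective h.injective⟩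

/-- The vertices covered by a set of edges. -/
def coveredVerts (F : Finset (Sym2 W)) : Finset W :=
  Finset.univ.filter fun v => ∃ e ∈ F, v ∈ e

/-- The number of edges of `F` at the vertex `u`. -/
def edgeDeg (F : Finset (Sym2 W)) (u : W) : ℕ :=
  (F.filter fun e => u ∈ e).card

/-- `χ` is proper on the set of edges `E`. -/
def ProperOn {β : Type} (E : Finset (Sym2 W)) (χ : Sym2 W → β) : Prop :=
  ∀ e ∈ E, ∀ e' ∈ E, e ≠ e' → (∃ v, v ∈ e ∧ v ∈ e') → χ e ≠ χ e'

/-- The anti-Ramsey property of a set of edges. -/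
def EdgeAntiRamsey (H : SimpleGraph V) (E : Finset (Sym2 W)) : Prop :=
  ∀ (β : Type) (χ : Sym2 W → β), ProperOn E χ →
    ∃ h : V ↪ W, copyEdges H h ⊆ E ∧ Set.InjOn χ (copyEdges H h : Set (Sym2 W))

lemma mem_copyEdges {H : SimpleGraph V} {h : V ↪ W} {e : Sym2 W} :
    e ∈ copyEdges H h ↔ ∃ x y, H.Adj x y ∧ s(h x, h y) = e := by
  simp only [copyEdges, Finset.mem_map, Set.Finite.mem_toFinset, Function.Embedding.coeFn_mk]
  constructor
  · rintro ⟨a, ha, rfl⟩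
    induction a with
    | _ x y => exact ⟨x, y, ha, by simp⟩
  · rintro ⟨x, y, hxy, rfl⟩
    exact ⟨s(x, y), hxy, by simp⟩

lemma card_copyEdges (H : SimpleGraph V) (h : V ↪ W) :
    (copyEdges H h).card = H.edgeSet.ncard := by
  rw [copyEdges, Finset.card_map, Set.ncard_eq_toFinset_card]

lemma AntiRamsey.edgeAntiRamsey {H : SimpleGraph V} {G : SimpleGraph W} (hG : AntiRamsey G H)
    {E : Finset (Sym2 W)} (hE : ∀ e, e ∈ E ↔ e ∈ G.edgeSet) : EdgeAntiRamsey H E := by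
  intro β χ hχ
  obtain ⟨f, hf, hr⟩ := hG β χ fun e he e' he' => hχ e ((hE e).2 he) e' ((hE e').2 he')
  refine ⟨f, fun e he => ?_, ?_⟩
  · obtain ⟨x, y, hxy, rfl⟩ := mem_copyEdges.1 he
    exact (hE _).2 (hf hxy)
  · intro e he e' he' hee
    obtain ⟨x, y, hxy, rfl⟩ := mem_copyEdges.1 he
    obtain ⟨x', y', hxy', rfl⟩ := mem_copyEdges.1 he'
    by_contra hne
    exact hr s(x, y) hxy s(x', y') hxy' (fun h => hne (by
      simpa using congrArg (Sym2.map f) h)) (by simpa using hee)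

/-- Colour a proper subset `E` of a minimal anti-Ramsey edge set without a rainbow copy, and the
remaining edges by `g` with fresh colours: some copy outside `E` is rainbow. -/
lemma exists_copy_of_minimal {H : SimpleGraph V} {E₀ : Finset (Sym2 W)}
    (hmin : Minimal (EdgeAntiRamsey H) E₀) {E : Finset (Sym2 W)} (hE : E ⊂ E₀)
    {β : Type} (g : Sym2 W → β) (hg : ProperOn (E₀ \ E) g) :
    ∃ h : V ↪ W, copyEdges H h ⊆ E₀ ∧ ¬ copyEdges H h ⊆ E ∧
      Set.InjOn g (copyEdges H h \ E : Finset (Sym2 W)) := by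
  have hnot : ¬ EdgeAntiRamsey H E := hmin.not_prop_of_lt hE
  simp only [EdgeAntiRamsey, not_forall] at hnot
  obtain ⟨β', χ, hχ, hno⟩ := hnot
  let ψ : Sym2 W → β' ⊕ β := fun e => if e ∈ E then Sum.inl (χ e) else Sum.inr (g e)
  obtain ⟨h, hsub, hinj⟩ := hmin.prop _ ψ (by
    intro e he e' he' hne hv
    by_cases h1 : e ∈ E <;> by_cases h2 : e' ∈ E <;> simp only [ψ, h1, h2, if_true, if_false]
    · simpa using hχ e h1 e' h2 hne hv
    · simp
    · simp
    · simpa using hg e (by simp [he, h1]) e' (by simp [he', h2]) hne hv)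
  refine ⟨h, hsub, fun hc => hno ⟨h, hc, ?_⟩, ?_⟩
  · intro e he e' he' hee
    exact hinj he he' (by simp [ψ, hc he, hc he', hee])
  · intro e he e' he' hee
    simp only [Finset.coe_sdiff, Set.mem_sdiff, Finset.mem_coe] at he he'
    exact hinj he.1 he'.1 (by simp [ψ, he.2, he'.2, hee])

/-- The copies of `H` in a minimal anti-Ramsey edge set are connected through common edges. -/
lemma exists_copy_crossing {H : SimpleGraph V} {E₀ : Finset (Sym2 W)}
    (hmin : Minimal (EdgeAntiRamsey H) E₀) {F : Finset (Sym2 W)} (hF : F ⊂ E₀)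
    (hne : F.Nonempty) :
    ∃ h : V ↪ W, copyEdges H h ⊆ E₀ ∧ (∃ e ∈ copyEdges H h, e ∈ F) ∧ ¬ copyEdges H h ⊆ F := by
  have hnot : ¬ EdgeAntiRamsey H F := hmin.not_prop_of_lt hF
  simp only [EdgeAntiRamsey, not_forall] at hnot
  obtain ⟨β, χ, hχ, hno⟩ := hnot
  have hss : E₀ \ (E₀ \ F) = F := by
    rw [sdiff_sdiff_right_self]; exact Finset.inter_eq_right.2 hF.1
  obtain ⟨h, hsub, hnsub, hinj⟩ := exists_copy_of_minimal hmin (E := E₀ \ F)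
    (Finset.sdiff_ssubset hF.1 hne) χ (by rwa [hss])
  refine ⟨h, hsub, ?_, fun hc => hno ⟨h, hc, ?_⟩⟩
  · obtain ⟨e, he, he'⟩ := Finset.not_subset.1 hnsub
    exact ⟨e, he, by simpa [hsub he] using he'⟩
  · have : copyEdges H h \ (E₀ \ F) = copyEdges H h := by
      ext e; simp only [Finset.mem_sdiff]; have := @hc e; tauto
    rwa [this] at hinj

lemma minDeg_le_edgeDeg_copyEdges (H : SimpleGraph V) (h : V ↪ W) (x : V) :
    minDeg H ≤ edgeDeg (copyEdges H h) (h x) := by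
  have h1 : minDeg H ≤ (H.neighborSet x).ncard := Nat.sInf_le ⟨x, rfl⟩
  refine h1.trans ?_
  rw [edgeDeg, ← Set.ncard_coe_finset]
  refine Set.ncard_le_ncard_of_injOn (fun y => s(h x, h y)) ?_ ?_ (Finset.finite_toSet _)
  · intro y hy
    simp only [Finset.coe_filter, Set.mem_ofPred_eq]
    exact ⟨mem_copyEdges.2 ⟨x, y, hy, rfl⟩, by simp⟩
  · intro y _ y' _ hyy
    exact h.injective (Sym2.congr_right.1 hyy)

lemma mem_copyEdges_of_edgeDeg_eq {H : SimpleGraph V} {E : Finset (Sym2 W)} {h : V ↪ W}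
    (hsub : copyEdges H h ⊆ E) {u : W} (hu : edgeDeg E u = minDeg H)
    {e₀ : Sym2 W} (he₀ : e₀ ∈ copyEdges H h) (hue₀ : u ∈ e₀)
    {e : Sym2 W} (he : e ∈ E) (hue : u ∈ e) : e ∈ copyEdges H h := by
  obtain ⟨x, rfl⟩ : ∃ x, h x = u := by
    obtain ⟨x, y, -, rfl⟩ := mem_copyEdges.1 he₀
    rcases Sym2.mem_iff.1 hue₀ with h | h
    · exact ⟨x, h.symm⟩
    · exact ⟨y, h.symm⟩
  have := Finset.eq_of_subset_of_card_le (Finset.filter_subset_filter (fun e => h x ∈ e) hsub)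
    (by have := minDeg_le_edgeDeg_copyEdges H h x
        simp only [edgeDeg] at this hu; omega)
  have h2 : e ∈ E.filter (fun e => h x ∈ e) := by simp [he, hue]
  rw [← this] at h2
  exact (Finset.mem_filter.1 h2).1

/-- Through each covered vertex of a minimal anti-Ramsey edge set there is a copy of `H`. -/
lemma exists_copy_at_vertex {H : SimpleGraph V} {E₀ : Finset (Sym2 W)}
    (hmin : Minimal (EdgeAntiRamsey H) E₀) {u : W} (hu : ∃ e ∈ E₀, u ∈ e) :
    ∃ h : V ↪ W, copyEdges H h ⊆ E₀ ∧ ∃ e ∈ copyEdges H h, u ∈ e := by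
  obtain ⟨e, he, hue⟩ := hu
  obtain ⟨h, hsub, hnot, -⟩ := exists_copy_of_minimal hmin (E := E₀.filter fun e => u ∉ e)
    (Finset.filter_ssubset.2 ⟨e, he, by simpa using hue⟩) id (fun e _ e' _ hne _ => hne)
  obtain ⟨e', he', hn⟩ := Finset.not_subset.1 hnot
  exact ⟨h, hsub, e', he', by simpa [hsub he'] using hn⟩

lemma minDeg_le_edgeDeg {H : SimpleGraph V} {E₀ : Finset (Sym2 W)}
    (hmin : Minimal (EdgeAntiRamsey H) E₀) {u : W} (hu : ∃ e ∈ E₀, u ∈ e) :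
    minDeg H ≤ edgeDeg E₀ u := by
  obtain ⟨h, hsub, e, he, hue⟩ := exists_copy_at_vertex hmin hu
  obtain ⟨x, rfl⟩ : ∃ x, h x = u := by
    obtain ⟨x, y, -, rfl⟩ := mem_copyEdges.1 he
    rcases Sym2.mem_iff.1 hue with h | h
    · exact ⟨x, h.symm⟩
    · exact ⟨y, h.symm⟩
  exact (minDeg_le_edgeDeg_copyEdges H h x).trans
    (Finset.card_le_card (Finset.filter_subset_filter _ hsub))

/-- If `u` and `v` have minimum degree and are joined by an edge, they have no two disjoint
further edges. -/
lemma eq_of_adjacent_minDeg {H : SimpleGraph V} {E₀ : Finset (Sym2 W)}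
    (hmin : Minimal (EdgeAntiRamsey H) E₀) (hdiag : ∀ e ∈ E₀, ¬ e.IsDiag) {u v x y : W}
    (huv : s(u, v) ∈ E₀) (hu : edgeDeg E₀ u = minDeg H) (hv : edgeDeg E₀ v = minDeg H)
    (hx : s(u, x) ∈ E₀) (hy : s(v, y) ∈ E₀) (hxv : x ≠ v) (hyu : y ≠ u) : x = y := by
  by_contra hxy
  have huv' : u ≠ v := by simpa using hdiag _ huv
  have hne : s(u, x) ≠ s(v, y) := by
    intro h; rcases Sym2.eq_iff.1 h with h | h
    · exact huv' h.1
    · exact hxv h.2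
  have hdisj : ¬ ∃ w, w ∈ s(u, x) ∧ w ∈ s(v, y) := by
    rintro ⟨w, h1, h2⟩
    rcases Sym2.mem_iff.1 h1 with rfl | rfl <;> rcases Sym2.mem_iff.1 h2 with h2 | h2
    · exact huv' h2
    · exact hyu h2.symm
    · exact hxv h2
    · exact hxy h2
  obtain ⟨h, hsub, hnot, hinj⟩ := exists_copy_of_minimal hmin
    (E := E₀.filter fun e => u ∉ e ∧ v ∉ e)
    (Finset.filter_ssubset.2 ⟨_, huv, by simp⟩)
    (fun e => if e = s(v, y) then s(u, x) else e) (by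
      intro e _ e' _ hee hw
      by_cases h1 : e = s(v, y) <;> by_cases h2 : e' = s(v, y) <;> simp only [h1, h2, if_true, if_false]
      · exact absurd (h1.trans h2.symm) hee
      · rintro rfl; subst h1; exact hdisj (by obtain ⟨w, h1, h2⟩ := hw; exact ⟨w, h2, h1⟩)
      · rintro rfl; subst h2; exact hdisj hw
      · exact hee)
  obtain ⟨e, he, hn⟩ := Finset.not_subset.1 hnot
  have key : s(u, v) ∈ copyEdges H h := by
    have : u ∈ e ∨ v ∈ e := by
      by_contra hc; push Not at hc; exact hn (by simp [hsub he, hc])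
    rcases this with h1 | h1
    · exact mem_copyEdges_of_edgeDeg_eq hsub hu he h1 huv (by simp)
    · exact mem_copyEdges_of_edgeDeg_eq hsub hv he h1 huv (by simp)
  have k1 := mem_copyEdges_of_edgeDeg_eq hsub hu key (by simp) hx (by simp)
  have k2 := mem_copyEdges_of_edgeDeg_eq hsub hv key (by simp) hy (by simp)
  exact hne (hinj (by simp [k1]) (by simp [k2]) (by simp))

lemma exists_triangle_subgraph {H : SimpleGraph V} {a b c : V} (hab : H.Adj a b)
    (hac : H.Adj a c) (hbc : H.Adj b c) :
    ∃ J : H.Subgraph, 2 ≤ d2val J.edgeSet.ncard J.verts.ncard := by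
  classical
  let J : H.Subgraph := (⊤ : H.Subgraph).induce {a, b, c}
  refine ⟨J, ?_⟩
  have hv : J.verts.ncard = 3 := by
    have : J.verts = {a, b, c} := rfl
    rw [this]
    exact Set.ncard_eq_three.2 ⟨a, b, c, hab.ne, hac.ne, hbc.ne, rfl⟩
  have he : 3 ≤ J.edgeSet.ncard := by
    have h1 : ({s(a, b), s(a, c), s(b, c)} : Set (Sym2 V)) ⊆ J.edgeSet := by
      intro e he
      simp only [Set.mem_insert_iff, Set.mem_singleton_iff] at he
      rcases he with rfl | rfl | rfl <;> simp [J, hab, hac, hbc]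
    have h2 : ({s(a, b), s(a, c), s(b, c)} : Set (Sym2 V)).ncard = 3 := by
      refine Set.ncard_eq_three.2 ⟨_, _, _, ?_, ?_, ?_, rfl⟩ <;>
        simp [hab.ne, hac.ne, hbc.ne, hab.ne', hbc.ne']
    exact h2 ▸ Set.ncard_le_ncard h1 (Set.toFinite _)
  rw [d2val, if_pos ⟨by omega, by omega⟩, hv]
  have : (3 : ℝ) ≤ J.edgeSet.ncard := by exact_mod_cast he
  norm_num
  linarith

lemma exists_mem_ne_of_two_le_edgeDeg {E : Finset (Sym2 W)} {u : W} {k : ℕ}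
    (S : Finset W) (hS : S.card ≤ k) (hk : k < edgeDeg E u) :
    ∃ x, s(u, x) ∈ E ∧ x ∉ S := by
  by_contra hc
  push Not at hc
  have : (E.filter fun e => u ∈ e) ⊆ S.image fun x => s(u, x) := by
    intro e he
    obtain ⟨he, hue⟩ := Finset.mem_filter.1 he
    obtain ⟨x, rfl⟩ := Sym2.mem_iff_exists.1 hue
    exact Finset.mem_image_of_mem _ (hc x he)
  have h1 := (Finset.card_le_card this).trans Finset.card_image_le
  simp only [edgeDeg] at hk
  omega

lemma twoDensity_set_bddAbove (H : SimpleGraph V) :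
    BddAbove {x : ℝ | ∃ J : H.Subgraph, x = d2val J.edgeSet.ncard J.verts.ncard} := by
  have : Finite H.Subgraph := inferInstance
  have h := Set.finite_range fun J : H.Subgraph => d2val J.edgeSet.ncard J.verts.ncard
  refine (h.subset ?_).bddAbove
  rintro x ⟨J, rfl⟩
  exact ⟨J, rfl⟩

lemma d2val_le_twoDensity {H : SimpleGraph V} (J : H.Subgraph) :
    d2val J.edgeSet.ncard J.verts.ncard ≤ twoDensity H :=
  le_csSup (twoDensity_set_bddAbove H) ⟨J, rfl⟩

lemma not_adjacent_minDeg {H : SimpleGraph V} (hm1 : 1 < twoDensity H)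
    (hm2 : twoDensity H <
      ((minDeg H : ℝ) * ((minDeg H : ℝ) + 1)) / (2 * (minDeg H : ℝ) + 1))
    {E₀ : Finset (Sym2 W)} (hmin : Minimal (EdgeAntiRamsey H) E₀)
    (hdiag : ∀ e ∈ E₀, ¬ e.IsDiag) {u v : W} (hu : edgeDeg E₀ u = minDeg H)
    (hv : edgeDeg E₀ v = minDeg H) : s(u, v) ∉ E₀ := by
  intro huv
  have huv' : u ≠ v := by simpa using hdiag _ huv
  have hδ : 2 ≤ minDeg H := by
    by_contra hc
    have h := hm1.trans hm2
    have : minDeg H = 0 ∨ minDeg H = 1 := by omega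
    rcases this with h' | h' <;> rw [h'] at h <;> norm_num at h
  obtain ⟨x, hx, hxv⟩ := exists_mem_ne_of_two_le_edgeDeg (E := E₀) (u := u) (k := 1) {v}
    (by simp) (by omega)
  obtain ⟨y, hy, hyu⟩ := exists_mem_ne_of_two_le_edgeDeg (E := E₀) (u := v) (k := 1) {u}
    (by simp) (by omega)
  simp only [Finset.mem_singleton] at hxv hyu
  obtain rfl := eq_of_adjacent_minDeg hmin hdiag huv hu hv hx hy hxv hyu
  rcases hδ.eq_or_lt with h2 | h3
  · obtain ⟨h, hsub, e, he, hue⟩ := exists_copy_at_vertex hmin (u := u) ⟨_, huv, by simp⟩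
    have k1 := mem_copyEdges_of_edgeDeg_eq hsub hu he hue huv (by simp)
    have k2 := mem_copyEdges_of_edgeDeg_eq hsub hu he hue hx (by simp)
    have k3 := mem_copyEdges_of_edgeDeg_eq hsub hv k1 (by simp) hy (by simp)
    have adj : ∀ {p q : W}, s(p, q) ∈ copyEdges H h → ∃ a b, H.Adj a b ∧ h a = p ∧ h b = q := by
      intro p q hpq
      obtain ⟨a, b, hab, hh⟩ := mem_copyEdges.1 hpq
      rcases Sym2.eq_iff.1 hh with hh | hh
      · exact ⟨a, b, hab, hh.1, hh.2⟩
      · exact ⟨b, a, hab.symm, hh.2, hh.1⟩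
    obtain ⟨a, b, hab, rfl, rfl⟩ := adj k1
    obtain ⟨a', c, hac, ha, rfl⟩ := adj k2
    obtain ⟨b', c', hbc, hb, hc⟩ := adj k3
    obtain rfl := h.injective ha
    obtain rfl := h.injective hb
    obtain rfl := h.injective hc
    obtain ⟨J, hJ⟩ := exists_triangle_subgraph hab hac hbc
    have := hJ.trans (d2val_le_twoDensity J)
    rw [← h2] at hm2
    norm_num at hm2
    linarith
  · obtain ⟨z, hz, hzv⟩ := exists_mem_ne_of_two_le_edgeDeg (E := E₀) (u := u) (k := 2) {v, x}
      Finset.card_le_two (by omega)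
    simp only [Finset.mem_insert, Finset.mem_singleton, not_or] at hzv
    exact hzv.2 (eq_of_adjacent_minDeg hmin hdiag huv hu hv hz hy hzv.1 hyu)

lemma sum_edgeDeg {E : Finset (Sym2 W)} (hdiag : ∀ e ∈ E, ¬ e.IsDiag) :
    ∑ u ∈ coveredVerts E, edgeDeg E u = 2 * E.card := by
  have h1 := Finset.sum_card_bipartiteAbove_eq_sum_card_bipartiteBelow
    (s := coveredVerts E) (t := E) (fun u e => u ∈ e)
  have h2 : ∀ e ∈ E, ((coveredVerts E).bipartiteBelow (fun u e => u ∈ e) e).card = 2 := by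
    intro e he
    have := hdiag e he
    induction e with
    | _ x y =>
      have hxy : x ≠ y := by simpa using this
      rw [← Finset.card_pair hxy]
      congr 1
      ext w
      simp only [Finset.bipartiteBelow, coveredVerts, Finset.mem_filter, Finset.mem_univ, true_and,
        Sym2.mem_iff, Finset.mem_insert, Finset.mem_singleton, and_iff_right_iff_imp]
      exact fun hw => ⟨_, he, Sym2.mem_iff.2 hw⟩
  rw [Finset.sum_congr rfl h2] at h1
  simp only [Finset.sum_const, smul_eq_mul] at h1
  rw [mul_comm 2, ← h1]
  rfl

/-- A minimal anti-Ramsey edge set is dense. -/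
lemma density_le_of_minimal {H : SimpleGraph V} (hm1 : 1 < twoDensity H)
    (hm2 : twoDensity H <
      ((minDeg H : ℝ) * ((minDeg H : ℝ) + 1)) / (2 * (minDeg H : ℝ) + 1))
    {E₀ : Finset (Sym2 W)} (hmin : Minimal (EdgeAntiRamsey H) E₀)
    (hdiag : ∀ e ∈ E₀, ¬ e.IsDiag) :
    ((minDeg H : ℝ) * ((minDeg H : ℝ) + 1)) / (2 * (minDeg H : ℝ) + 1) *
      (coveredVerts E₀).card ≤ E₀.card := by
  set δ := minDeg H with hδ
  let D := (coveredVerts E₀).filter fun u => edgeDeg E₀ u = δ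
  let B := (coveredVerts E₀).filter fun u => ¬ edgeDeg E₀ u = δ
  have hDB : D.card + B.card = (coveredVerts E₀).card :=
    Finset.card_filter_add_card_filter_not _
  have hsum : ∑ u ∈ D, edgeDeg E₀ u + ∑ u ∈ B, edgeDeg E₀ u = 2 * E₀.card := by
    rw [← sum_edgeDeg hdiag]
    exact Finset.sum_filter_add_sum_filter_not _ _ _
  have hsD : ∑ u ∈ D, edgeDeg E₀ u = D.card * δ := by
    rw [Finset.sum_const_nat]
    intro u hu
    exact (Finset.mem_filter.1 hu).2
  have hsB : B.card * (δ + 1) ≤ ∑ u ∈ B, edgeDeg E₀ u := by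
    rw [← smul_eq_mul]
    refine Finset.card_nsmul_le_sum _ _ _ fun u hu => ?_
    obtain ⟨hu, hne⟩ := Finset.mem_filter.1 hu
    have := minDeg_le_edgeDeg hmin (Finset.mem_filter.1 hu).2
    omega
  have hDE : D.card * δ ≤ E₀.card := by
    rw [← hsD]
    have hdis : (D : Set W).PairwiseDisjoint fun u => E₀.filter fun e => u ∈ e := by
      intro u hu v hv huv
      refine Finset.disjoint_left.2 fun e he he' => ?_
      obtain ⟨h1, h2⟩ := Finset.mem_filter.1 he
      obtain ⟨-, h3⟩ := Finset.mem_filter.1 he'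
      rw [(Sym2.mem_and_mem_iff huv).1 ⟨h2, h3⟩] at h1
      exact not_adjacent_minDeg hm1 hm2 hmin hdiag (Finset.mem_filter.1 hu).2
        (Finset.mem_filter.1 hv).2 h1
    have := Finset.card_biUnion hdis
    simp only [edgeDeg]
    rw [← this]
    exact Finset.card_le_card (Finset.biUnion_subset.2 fun u _ => Finset.filter_subset _ _)
  have hfin : δ * (δ + 1) * (D.card + B.card) ≤ E₀.card * (2 * δ + 1) := by nlinarith
  rw [hDB] at hfin
  rw [div_mul_eq_mul_div, div_le_iff₀ (by positivity)]
  exact_mod_cast hfin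

/-- The excess of the number of edges of `F` over `m` times the number of vertices. -/
noncomputable def excess (m : ℝ) (F : Finset (Sym2 W)) : ℝ :=
  F.card - m * (coveredVerts F).card

/-- A nonempty set of edges of excess at least `γ`, connected by copies of `H`. -/
structure IsCore (H : SimpleGraph V) (m γ : ℝ) (E : Finset (Sym2 W)) : Prop where
  nonempty : E.Nonempty
  le_excess : γ ≤ excess m E
  crossing : ∀ F ⊂ E, F.Nonempty →
    ∃ h : V ↪ W, copyEdges H h ⊆ E ∧ (∃ e ∈ copyEdges H h, e ∈ F) ∧ ¬ copyEdges H h ⊆ F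

/-- Some core of `G` extends `F`, and all its copies of `H` that leave `F` do so through an edge
in `Q`. -/
def Live (H : SimpleGraph V) (m γ : ℝ) (F Q : Finset (Sym2 W)) (G : SimpleGraph W) : Prop :=
  ∃ E : Finset (Sym2 W), (∀ e ∈ E, e ∈ G.edgeSet) ∧ IsCore H m γ E ∧ F ⊆ E ∧
    ∀ h : V ↪ W, copyEdges H h ⊆ E → (∃ e ∈ copyEdges H h, e ∈ F) → ¬ copyEdges H h ⊆ F →
      ∃ e ∈ copyEdges H h, e ∈ Q

lemma AntiRamsey.exists_core {H : SimpleGraph V} (hm1 : 1 < twoDensity H)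
    (hm2 : twoDensity H <
      ((minDeg H : ℝ) * ((minDeg H : ℝ) + 1)) / (2 * (minDeg H : ℝ) + 1))
    (hedge : H.edgeSet.Nonempty) {G : SimpleGraph W} (hG : AntiRamsey G H) :
    ∃ E : Finset (Sym2 W), (∀ e ∈ E, e ∈ G.edgeSet) ∧ IsCore H (twoDensity H)
      (((minDeg H : ℝ) * ((minDeg H : ℝ) + 1)) / (2 * (minDeg H : ℝ) + 1) - twoDensity H) E := by
  obtain ⟨E, hsub, hmin⟩ := exists_minimal_le_of_wellFoundedLT (EdgeAntiRamsey H)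
    G.edgeSet.toFinite.toFinset (hG.edgeAntiRamsey (by simp))
  have hEG : ∀ e ∈ E, e ∈ G.edgeSet := fun e he => by simpa using hsub he
  have hdiag : ∀ e ∈ E, ¬ e.IsDiag := fun e he => G.not_isDiag_of_mem_edgeSet (hEG e he)
  have hne : E.Nonempty := by
    obtain ⟨h, hs, -⟩ := hmin.prop _ id (fun e _ e' _ hne _ => hne)
    obtain ⟨e, he⟩ := hedge
    induction e with
    | _ x y => exact ⟨_, hs (mem_copyEdges.2 ⟨x, y, he, rfl⟩)⟩
  refine ⟨E, hEG, hne, ?_, fun F hF hFne => exists_copy_crossing hmin hF hFne⟩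
  have hd := density_le_of_minimal hm1 hm2 hmin hdiag
  have hv : (1 : ℝ) ≤ (coveredVerts E).card := by
    obtain ⟨e, he⟩ := hne
    have : (coveredVerts E).Nonempty := by
      induction e with
      | _ x y => exact ⟨x, Finset.mem_filter.2 ⟨Finset.mem_univ _, _, he, by simp⟩⟩
    exact_mod_cast this.card_pos
  rw [excess]
  nlinarith

lemma Live.subset {H : SimpleGraph V} {m γ : ℝ} {F Q : Finset (Sym2 W)} {G : SimpleGraph W}
    (h : Live H m γ F Q G) : ∀ e ∈ F, e ∈ G.edgeSet := by
  obtain ⟨E, hE, -, hF, -⟩ := h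
  exact fun e he => hE e (hF he)

lemma Live.le_excess {H : SimpleGraph V} {m γ : ℝ} {F : Finset (Sym2 W)} {G : SimpleGraph W}
    (h : Live H m γ F ∅ G) (hF : F.Nonempty) : γ ≤ excess m F := by
  obtain ⟨E, -, hE, hFE, hq⟩ := h
  rcases hFE.eq_or_ssubset with rfl | hss
  · exact hE.le_excess
  · obtain ⟨h, h1, h2, h3⟩ := hE.crossing F hss hF
    obtain ⟨e, -, he⟩ := hq h h1 h2 h3
    simp at he

lemma Live.step {H : SimpleGraph V} {m γ : ℝ} {F Q : Finset (Sym2 W)} {G : SimpleGraph W}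
    (hL : Live H m γ F Q G) (e : Sym2 W) :
    Live H m γ F (Q.erase e) G ∨ ∃ h : V ↪ W, (e ∈ copyEdges H h ∧ ¬ copyEdges H h ⊆ F) ∧
      Live H m γ (F ∪ copyEdges H h) (Q ∪ (copyEdges H h \ F)) G := by
  obtain ⟨E, hEG, hE, hFE, hq⟩ := hL
  by_cases hc : ∃ h : V ↪ W, copyEdges H h ⊆ E ∧ e ∈ copyEdges H h ∧ ¬ copyEdges H h ⊆ F
  · obtain ⟨h, hsub, he, hnot⟩ := hc
    refine Or.inr ⟨h, ⟨he, hnot⟩, E, hEG, hE, Finset.union_subset hFE hsub, ?_⟩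
    rintro h' hsub' ⟨f, hf, hf'⟩ hnot'
    by_cases hfF : f ∈ F
    · obtain ⟨e', he', he''⟩ := hq h' hsub' ⟨f, hf, hfF⟩
        fun hs => hnot' (hs.trans Finset.subset_union_left)
      exact ⟨e', he', Finset.mem_union_left _ he''⟩
    · refine ⟨f, hf, Finset.mem_union_right _ (Finset.mem_sdiff.2 ⟨?_, hfF⟩)⟩
      exact (Finset.mem_union.1 hf').resolve_left hfF
  · refine Or.inl ⟨E, hEG, hE, hFE, fun h hsub hmeet hnot => ?_⟩
    obtain ⟨e', he', hQ⟩ := hq h hsub hmeet hnot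
    refine ⟨e', he', Finset.mem_erase.2 ⟨?_, hQ⟩⟩
    rintro rfl
    exact hc ⟨h, hsub, he', hnot⟩

lemma IsCore.live {H : SimpleGraph V} {m γ : ℝ} {E : Finset (Sym2 W)} {G : SimpleGraph W}
    (hE : IsCore H m γ E) (hEG : ∀ e ∈ E, e ∈ G.edgeSet) :
    ∃ e : Sym2 W, ¬ e.IsDiag ∧ Live H m γ {e} {e} G := by
  obtain ⟨e, he⟩ := hE.nonempty
  refine ⟨e, G.not_isDiag_of_mem_edgeSet (hEG e he), E, hEG, hE, by simpa using he, ?_⟩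
  exact fun h _ hmeet _ => hmeet

/-- The vertices of `H` that `h` maps to vertices covered by `F`. -/
def oldVerts (F : Finset (Sym2 W)) (h : V ↪ W) : Finset V :=
  Finset.univ.filter fun x => h x ∈ coveredVerts F

/-- The part of `H` that `h` maps into `F`. -/
def oldSubgraph (H : SimpleGraph V) (F : Finset (Sym2 W)) (h : V ↪ W) : H.Subgraph where
  verts := {x | h x ∈ coveredVerts F}
  Adj x y := H.Adj x y ∧ s(h x, h y) ∈ F
  adj_sub := And.left
  edge_vert hxy := Finset.mem_filter.2 ⟨Finset.mem_univ _, _, hxy.2, by simp⟩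
  symm := ⟨fun x y hxy => ⟨hxy.1.symm, by rw [Sym2.eq_swap]; exact hxy.2⟩⟩

lemma oldSubgraph_verts_ncard (H : SimpleGraph V) (F : Finset (Sym2 W)) (h : V ↪ W) :
    (oldSubgraph H F h).verts.ncard = (oldVerts F h).card := by
  rw [← Set.ncard_coe_finset]
  congr 1
  ext x
  simp [oldSubgraph, oldVerts]

lemma oldSubgraph_edgeSet_ncard (H : SimpleGraph V) (F : Finset (Sym2 W)) (h : V ↪ W) :
    (oldSubgraph H F h).edgeSet.ncard = (copyEdges H h ∩ F).card := by
  rw [← Set.ncard_image_of_injective _ (Sym2.map.injective h.injective), ← Set.ncard_coe_finset]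
  congr 1
  ext e
  simp only [Set.mem_image, Finset.coe_inter, Set.mem_inter_iff, Finset.mem_coe]
  constructor
  · rintro ⟨a, ha, rfl⟩
    induction a with
    | _ x y => exact ⟨mem_copyEdges.2 ⟨x, y, ha.1, by simp⟩, by simpa using ha.2⟩
  · rintro ⟨h1, h2⟩
    obtain ⟨x, y, hxy, rfl⟩ := mem_copyEdges.1 h1
    exact ⟨s(x, y), ⟨hxy, h2⟩, by simp⟩

lemma oldSubgraph_ne_top {H : SimpleGraph V} {F : Finset (Sym2 W)} {h : V ↪ W}
    (hnot : ¬ copyEdges H h ⊆ F) : oldSubgraph H F h ≠ ⊤ := by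
  intro htop
  refine hnot fun e he => ?_
  obtain ⟨x, y, hxy, rfl⟩ := mem_copyEdges.1 he
  have : (oldSubgraph H F h).Adj x y := by rw [htop]; exact hxy
  exact this.2

lemma card_coveredVerts_union {H : SimpleGraph V} (hdeg : ∀ x, ∃ y, H.Adj x y)
    (F : Finset (Sym2 W)) (h : V ↪ W) :
    (coveredVerts (F ∪ copyEdges H h)).card + (oldVerts F h).card =
      (coveredVerts F).card + Fintype.card V := by
  have h1 : coveredVerts (F ∪ copyEdges H h) = coveredVerts F ∪ Finset.univ.map h := by
    ext v
    simp only [coveredVerts, Finset.mem_filter, Finset.mem_univ, true_and, Finset.mem_union,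
      Finset.mem_map]
    constructor
    · rintro ⟨e, he | he, hv⟩
      · exact Or.inl ⟨e, he, hv⟩
      · obtain ⟨x, y, -, rfl⟩ := mem_copyEdges.1 he
        rcases Sym2.mem_iff.1 hv with rfl | rfl
        · exact Or.inr ⟨x, rfl⟩
        · exact Or.inr ⟨y, rfl⟩
    · rintro (⟨e, he, hv⟩ | ⟨x, rfl⟩)
      · exact ⟨e, Or.inl he, hv⟩
      · obtain ⟨y, hy⟩ := hdeg x
        exact ⟨_, Or.inr (mem_copyEdges.2 ⟨x, y, hy, rfl⟩), by simp⟩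
  have h2 : (oldVerts F h).map h = coveredVerts F ∩ Finset.univ.map h := by
    ext v
    simp only [oldVerts, Finset.mem_map, Finset.mem_filter, Finset.mem_univ, true_and,
      Finset.mem_inter]
    constructor
    · rintro ⟨x, hx, rfl⟩; exact ⟨hx, x, rfl⟩
    · rintro ⟨hv, x, rfl⟩; exact ⟨x, hv, rfl⟩
  rw [h1, ← Finset.card_map h (s := oldVerts F h), h2, Finset.card_union_add_card_inter,
    Finset.card_map, Finset.card_univ]

lemma mem_coveredVerts {F : Finset (Sym2 W)} {e : Sym2 W} (he : e ∈ F) {v : W} (hv : v ∈ e) :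
    v ∈ coveredVerts F :=
  Finset.mem_filter.2 ⟨Finset.mem_univ _, e, he, hv⟩

open scoped Classical in
/-- If a copy of `H` through `e ∈ F` has at most two vertices in `F`, these are the ends of `e`. -/
lemma exists_oldVerts_eq_pair {H : SimpleGraph V} {F : Finset (Sym2 W)} {h : V ↪ W} {e : Sym2 W}
    (he : e ∈ copyEdges H h) (heF : e ∈ F) (hcard : (oldVerts F h).card ≤ 2) :
    ∃ x y, x ≠ y ∧ oldVerts F h = {x, y} ∧ s(h x, h y) = e := by
  obtain ⟨x, y, hxy, rfl⟩ := mem_copyEdges.1 he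
  refine ⟨x, y, hxy.ne, ?_, rfl⟩
  symm
  refine Finset.eq_of_subset_of_card_le ?_ (by rwa [Finset.card_pair hxy.ne])
  intro z hz
  refine Finset.mem_filter.2 ⟨Finset.mem_univ _, mem_coveredVerts heF ?_⟩
  rcases Finset.mem_insert.1 hz with rfl | hz
  · simp
  · rw [Finset.mem_singleton.1 hz]; simp

lemma card_inter_of_card_oldVerts_le {H : SimpleGraph V} {F : Finset (Sym2 W)} {h : V ↪ W}
    {e : Sym2 W} (he : e ∈ copyEdges H h) (heF : e ∈ F) (hcard : (oldVerts F h).card ≤ 2) :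
    copyEdges H h ∩ F = {e} := by
  classical
  obtain ⟨x, y, hne, hA, rfl⟩ := exists_oldVerts_eq_pair he heF hcard
  refine Finset.eq_singleton_iff_unique_mem.2 ⟨by simp [he, heF], fun e' he' => ?_⟩
  obtain ⟨h1, h2⟩ := Finset.mem_inter.1 he'
  obtain ⟨x', y', hxy', rfl⟩ := mem_copyEdges.1 h1
  have hx : x' ∈ oldVerts F h :=
    Finset.mem_filter.2 ⟨Finset.mem_univ _, mem_coveredVerts h2 (by simp)⟩
  have hy : y' ∈ oldVerts F h :=
    Finset.mem_filter.2 ⟨Finset.mem_univ _, mem_coveredVerts h2 (by simp)⟩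
  have := hxy'.ne
  rw [hA] at hx hy
  simp only [Finset.mem_insert, Finset.mem_singleton] at hx hy
  rcases hx with rfl | rfl <;> rcases hy with rfl | rfl <;> simp_all [Sym2.eq_swap]

/-- Adding to `F` a copy of `H` through an edge of `F` does not decrease the excess, and increases
it unless the copy shares only this edge with `F`. -/
lemma excess_gain {H : SimpleGraph V} {m ε : ℝ}
    (hmH : (H.edgeSet.ncard : ℝ) - 1 = m * (Fintype.card V - 2)) (hε0 : 0 < ε)
    (hε : ∀ J : H.Subgraph, J ≠ ⊤ → d2val J.edgeSet.ncard J.verts.ncard + ε ≤ m)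
    {F : Finset (Sym2 W)} {h : V ↪ W} {e : Sym2 W} (he : e ∈ copyEdges H h) (heF : e ∈ F)
    (hnot : ¬ copyEdges H h ⊆ F) :
    (if (oldVerts F h).card ≤ 2 then 0 else ε) ≤
      ((copyEdges H h \ F).card : ℝ) - m * (Fintype.card V - (oldVerts F h).card) := by
  have hsplit : ((copyEdges H h \ F).card : ℝ) + (copyEdges H h ∩ F).card = H.edgeSet.ncard := by
    rw [← card_copyEdges H h]
    exact_mod_cast Finset.card_sdiff_add_card_inter _ _
  split_ifs with hA
  · have h1 := card_inter_of_card_oldVerts_le he heF hA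
    obtain ⟨x, y, hne, hA, -⟩ := exists_oldVerts_eq_pair he heF hA
    rw [h1] at hsplit
    classical
    rw [hA, Finset.card_pair hne]
    push_cast at hsplit ⊢
    simp at hsplit
    linarith
  · push Not at hA
    have h1 := hε _ (oldSubgraph_ne_top hnot)
    have h2 : 1 ≤ (copyEdges H h ∩ F).card := Finset.card_pos.2 ⟨e, Finset.mem_inter.2 ⟨he, heF⟩⟩
    rw [oldSubgraph_verts_ncard, oldSubgraph_edgeSet_ncard, d2val, if_pos ⟨h2, hA⟩] at h1
    have h3 : (3 : ℝ) ≤ (oldVerts F h).card := by exact_mod_cast hA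
    have h4 : (((copyEdges H h ∩ F).card : ℝ) - 1) ≤ (m - ε) * ((oldVerts F h).card - 2) := by
      rw [← div_le_iff₀ (by linarith)]
      linarith
    nlinarith

lemma excess_union {H : SimpleGraph V} (hdeg : ∀ x, ∃ y, H.Adj x y) (m : ℝ)
    (F : Finset (Sym2 W)) (h : V ↪ W) :
    excess m (F ∪ copyEdges H h) = excess m F +
      (((copyEdges H h \ F).card : ℝ) - m * (Fintype.card V - (oldVerts F h).card)) := by
  have h1 : ((coveredVerts (F ∪ copyEdges H h)).card : ℝ) + (oldVerts F h).card =
      (coveredVerts F).card + Fintype.card V := by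
    exact_mod_cast card_coveredVerts_union hdeg F h
  have h2 : ((F ∪ copyEdges H h).card : ℝ) = F.card + (copyEdges H h \ F).card := by
    rw [Finset.card_union, ← Finset.card_sdiff_add_card_inter (copyEdges H h) F,
      Finset.inter_comm F]
    have : F.card + ((copyEdges H h \ F).card + (copyEdges H h ∩ F).card) -
      (copyEdges H h ∩ F).card = F.card + (copyEdges H h \ F).card := by omega
    exact_mod_cast this
  rw [excess, excess, h2]
  linear_combination -m * h1

/-- The weight bounding the probability that the exploration reaches `F` with active edges `Q`. -/
noncomputable def weight (q N α m : ℝ) (F Q : Finset (Sym2 W)) : ℝ :=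
  q ^ F.card * 2 ^ Q.card * N ^ (α * excess m F)

lemma weight_union_le {H : SimpleGraph V} (hdeg : ∀ x, ∃ y, H.Adj x y) {m ε : ℝ} (hm0 : 0 < m)
    (hmH : (H.edgeSet.ncard : ℝ) - 1 = m * (Fintype.card V - 2)) (hε0 : 0 < ε)
    (hε : ∀ J : H.Subgraph, J ≠ ⊤ → d2val J.edgeSet.ncard J.verts.ncard + ε ≤ m)
    {c β N : ℝ} (hc0 : 0 < c) (hc : 2 * c ≤ 1) (hβ : 0 ≤ β) (hN : 1 ≤ N)
    {F Q : Finset (Sym2 W)} {h : V ↪ W} {e : Sym2 W} (he : e ∈ copyEdges H h) (heF : e ∈ F)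
    (hnot : ¬ copyEdges H h ⊆ F) :
    weight (c * N ^ (-(1 / m))) N (1 / m - β) m (F ∪ copyEdges H h) (Q ∪ (copyEdges H h \ F)) ≤
      weight (c * N ^ (-(1 / m))) N (1 / m - β) m F Q * (2 * c *
        ((N ^ (Fintype.card V - (oldVerts F h).card))⁻¹ *
          (if (oldVerts F h).card ≤ 2 then 1 else N ^ (-(β * ε))))) := by
  have hN0 : 0 < N := by linarith
  set a := (copyEdges H h \ F).card with ha
  have ha1 : 1 ≤ a := Finset.card_pos.2 (Finset.sdiff_nonempty.2 hnot)
  set k := Fintype.card V - (oldVerts F h).card with hk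
  have hkr : (k : ℝ) = (Fintype.card V : ℝ) - (oldVerts F h).card := by
    rw [hk, Nat.cast_sub (Finset.card_le_univ _)]
  have hgain := excess_gain hmH hε0 hε he heF hnot
  rw [← ha, ← hkr] at hgain
  have hexc := excess_union hdeg m F h
  rw [← ha, ← hkr] at hexc
  have hFcard : (F ∪ copyEdges H h).card = F.card + a := by
    rw [ha, ← Finset.card_union_of_disjoint Finset.disjoint_sdiff, Finset.union_sdiff_self_eq_union]
  have hQcard : (Q ∪ (copyEdges H h \ F)).card ≤ Q.card + a := Finset.card_union_le _ _
  have hpow : (2 * c) ^ a ≤ 2 * c := pow_le_of_le_one (by positivity) hc (by omega)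
  have hrho : N ^ (-(β * ((a : ℝ) - m * k))) ≤
      if (oldVerts F h).card ≤ 2 then 1 else N ^ (-(β * ε)) := by
    split_ifs with hA
    · rw [if_pos hA] at hgain
      exact Real.rpow_le_one_of_one_le_of_nonpos hN (by nlinarith)
    · rw [if_neg hA] at hgain
      exact Real.rpow_le_rpow_of_exponent_le hN (by nlinarith)
  have hexp : (N ^ (-(1 / m))) ^ a * N ^ ((1 / m - β) * ((a : ℝ) - m * k)) =
      (N ^ k)⁻¹ * N ^ (-(β * ((a : ℝ) - m * k))) := by
    rw [← Real.rpow_natCast, ← Real.rpow_natCast, ← Real.rpow_mul hN0.le, ← Real.rpow_neg hN0.le,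
      ← Real.rpow_add hN0, ← Real.rpow_add hN0]
    congr 1
    field_simp
    ring
  set q := c * N ^ (-(1 / m)) with hq
  have hq0 : 0 < q := by positivity
  have hw0 : 0 < weight q N (1 / m - β) m F Q := by unfold weight; positivity
  calc weight q N (1 / m - β) m (F ∪ copyEdges H h) (Q ∪ (copyEdges H h \ F))
      ≤ q ^ (F.card + a) * 2 ^ (Q.card + a) *
          N ^ ((1 / m - β) * (excess m F + ((a : ℝ) - m * k))) := by
        rw [weight, hFcard, hexc]
        gcongr
        norm_num
    _ = weight q N (1 / m - β) m F Q * ((2 * c) ^ a *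
          ((N ^ (-(1 / m))) ^ a * N ^ ((1 / m - β) * ((a : ℝ) - m * k)))) := by
        rw [weight, mul_add, Real.rpow_add hN0, pow_add, pow_add, hq]
        simp only [mul_pow]
        ring
    _ ≤ _ := by
        rw [hexp]
        gcongr

open scoped Classical in
/-- The number of embeddings with prescribed set of old vertices `A`. -/
lemma card_filter_oldVerts_le (H : SimpleGraph V) {F : Finset (Sym2 W)} {e : Sym2 W}
    (heF : e ∈ F) (A : Finset V) :
    (Finset.univ.filter fun h : V ↪ W => e ∈ copyEdges H h ∧ oldVerts F h = A).card ≤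
      (if A.card ≤ 2 then 4 else (coveredVerts F).card ^ A.card) *
        Fintype.card W ^ (Fintype.card V - A.card) := by
  let B : Finset W := if A.card ≤ 2 then e.toFinset else coveredVerts F
  have h1 : (Finset.univ.filter fun h : V ↪ W => e ∈ copyEdges H h ∧ oldVerts F h = A).card ≤
      (Fintype.piFinset fun v => if v ∈ A then B else Finset.univ).card := by
    refine Finset.card_le_card_of_injOn (fun h => ⇑h) ?_ fun _ _ _ _ hh => DFunLike.coe_injective hh
    intro h hh
    obtain ⟨-, he, rfl⟩ := Finset.mem_filter.1 hh
    refine Finset.mem_coe.2 (Fintype.mem_piFinset.2 fun v => ?_)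
    split_ifs with hv
    · simp only [B]
      split_ifs with hA
      · obtain ⟨x, y, -, hA, rfl⟩ := exists_oldVerts_eq_pair he heF hA
        rw [hA] at hv
        rcases Finset.mem_insert.1 hv with rfl | hv
        · simp
        · rw [Finset.mem_singleton.1 hv]; simp
      · exact (Finset.mem_filter.1 hv).2
    · exact Finset.mem_univ _
  refine h1.trans ?_
  rw [Fintype.card_piFinset]
  have h2 : ∀ v, (if v ∈ A then B else Finset.univ).card =
      if v ∈ A then B.card else Fintype.card W := by
    intro v; split_ifs <;> simp
  simp_rw [h2]
  rw [Finset.prod_ite, Finset.prod_const, Finset.prod_const, Finset.filter_mem_eq_inter,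
    Finset.univ_inter, Finset.filter_not, Finset.filter_mem_eq_inter, Finset.univ_inter,
    Finset.card_univ_sdiff]
  refine Nat.mul_le_mul_right _ ?_
  simp only [B]
  split_ifs with hA
  · have h3 : e.toFinset.card ≤ 2 := by
      by_cases hd : e.IsDiag
      · rw [Sym2.card_toFinset_of_isDiag _ hd]; omega
      · rw [Sym2.card_toFinset_of_not_isDiag _ hd]
    calc e.toFinset.card ^ A.card ≤ 2 ^ A.card := Nat.pow_le_pow_left h3 _
      _ ≤ 2 ^ 2 := Nat.pow_le_pow_right (by norm_num) hA
  · exact le_rfl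

open scoped Classical in
lemma sum_weight_union_le {H : SimpleGraph V} (hdeg : ∀ x, ∃ y, H.Adj x y) {m ε : ℝ}
    (hm0 : 0 < m) (hmH : (H.edgeSet.ncard : ℝ) - 1 = m * (Fintype.card V - 2)) (hε0 : 0 < ε)
    (hε : ∀ J : H.Subgraph, J ≠ ⊤ → d2val J.edgeSet.ncard J.verts.ncard + ε ≤ m)
    {c β : ℝ} (hc0 : 0 < c) (hc : 2 ^ Fintype.card V * (4 * (2 * c)) ≤ 1 / 4) (hβ : 0 ≤ β)
    {L : ℝ} (hL : L ^ Fintype.card V * (Fintype.card W : ℝ) ^ (-(β * ε)) ≤ 1)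
    {F Q : Finset (Sym2 W)} {e : Sym2 W} (heF : e ∈ F) (hFL : (coveredVerts F).card ≤ L) :
    ∑ h : V ↪ W with e ∈ copyEdges H h ∧ ¬ copyEdges H h ⊆ F,
      weight (c * (Fintype.card W : ℝ) ^ (-(1 / m))) (Fintype.card W) (1 / m - β) m
        (F ∪ copyEdges H h) (Q ∪ (copyEdges H h \ F)) ≤
    1 / 4 * weight (c * (Fintype.card W : ℝ) ^ (-(1 / m))) (Fintype.card W) (1 / m - β) m F Q := by
  set N : ℝ := (Fintype.card W : ℝ) with hNdef
  have hcov : 1 ≤ (coveredVerts F).card := by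
    refine Finset.card_pos.2 ?_
    induction e with
    | _ x y => exact ⟨x, mem_coveredVerts heF (by simp)⟩
  have hL1 : 1 ≤ L := le_trans (by exact_mod_cast hcov) hFL
  have hN : 1 ≤ N := by
    have : (coveredVerts F).card ≤ Fintype.card W := Finset.card_le_univ _
    rw [hNdef]; exact_mod_cast hcov.trans this
  have hN0 : 0 < N := by linarith
  have hc' : 2 * c ≤ 1 := by
    have : (1 : ℝ) ≤ 2 ^ Fintype.card V := one_le_pow₀ (by norm_num)
    nlinarith
  set q := c * N ^ (-(1 / m)) with hq
  have hq0 : 0 < q := by positivity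
  set w := weight q N (1 / m - β) m F Q with hw
  have hw0 : 0 < w := by rw [hw]; unfold weight; positivity
  rw [← Finset.sum_fiberwise (s := Finset.univ.filter _) (g := fun h => oldVerts F h)]
  have hA : ∀ A : Finset V, ∑ h : V ↪ W with (e ∈ copyEdges H h ∧ ¬ copyEdges H h ⊆ F) ∧
      oldVerts F h = A, weight q N (1 / m - β) m
        (F ∪ copyEdges H h) (Q ∪ (copyEdges H h \ F)) ≤ w * (4 * (2 * c)) := by
    intro A
    have hb : ∀ h ∈ Finset.univ.filter fun h : V ↪ W => (e ∈ copyEdges H h ∧ ¬ copyEdges H h ⊆ F) ∧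
      oldVerts F h = A, weight q N (1 / m - β) m
        (F ∪ copyEdges H h) (Q ∪ (copyEdges H h \ F)) ≤ w * (2 * c *
        ((N ^ (Fintype.card V - A.card))⁻¹ * (if A.card ≤ 2 then 1 else N ^ (-(β * ε))))) := by
      intro h hh
      obtain ⟨-, ⟨he, hnot⟩, rfl⟩ := Finset.mem_filter.1 hh
      exact weight_union_le hdeg hm0 hmH hε0 hε hc0 hc' hβ hN he heF hnot
    refine (Finset.sum_le_card_nsmul _ _ _ hb).trans ?_
    rw [nsmul_eq_mul]
    have hcard : ((Finset.univ.filter fun h : V ↪ W => (e ∈ copyEdges H h ∧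
        ¬ copyEdges H h ⊆ F) ∧ oldVerts F h = A).card : ℝ) ≤
        (if A.card ≤ 2 then 4 else L ^ Fintype.card V) * N ^ (Fintype.card V - A.card) := by
      have h1 : ((Finset.univ.filter fun h : V ↪ W => e ∈ copyEdges H h ∧
          oldVerts F h = A).card : ℝ) ≤
          (if A.card ≤ 2 then 4 else ((coveredVerts F).card : ℝ) ^ A.card) *
          N ^ (Fintype.card V - A.card) := by
        rw [hNdef]
        exact_mod_cast card_filter_oldVerts_le H heF A
      refine le_trans ?_ (h1.trans ?_)
      · exact_mod_cast Finset.card_le_card fun h hh => by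
          simp only [Finset.mem_filter] at hh ⊢; tauto
      · gcongr
        split_ifs
        · exact le_rfl
        · exact (pow_le_pow_left₀ (by positivity) hFL _).trans
            (pow_le_pow_right₀ hL1 (Finset.card_le_univ _))
    refine (mul_le_mul_of_nonneg_right hcard ?_).trans ?_
    · have : 0 ≤ if A.card ≤ 2 then 1 else N ^ (-(β * ε)) := by split_ifs <;> positivity
      positivity
    · have hNk : N ^ (Fintype.card V - A.card) ≠ 0 := by positivity
      have : (if A.card ≤ 2 then 4 else L ^ Fintype.card V) * (if A.card ≤ 2 then 1 else
          N ^ (-(β * ε))) ≤ 4 := by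
        split_ifs <;> linarith
      calc _ = w * (((if A.card ≤ 2 then 4 else L ^ Fintype.card V) * (if A.card ≤ 2 then 1 else
          N ^ (-(β * ε)))) * (2 * c)) := by field_simp
        _ ≤ _ := by gcongr
  calc _ ≤ ∑ _A : Finset V, w * (4 * (2 * c)) := Finset.sum_le_sum fun A _ => by
        rw [Finset.filter_filter]; exact hA A
    _ = w * (2 ^ Fintype.card V * (4 * (2 * c))) := by
        rw [Finset.sum_const, Finset.card_univ, Fintype.card_finset, nsmul_eq_mul]
        push_cast
        ring
    _ ≤ _ := by nlinarith

end Deterministic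

section Probability

variable {n : ℕ} {p : ℝ}

lemma grProb_mono (hp0 : 0 ≤ p) (hp1 : p ≤ 1) {P Q : SimpleGraph (Fin n) → Prop}
    (h : ∀ G, P G → Q G) : grProb n p P ≤ grProb n p Q := by
  refine Finset.sum_le_sum fun G _ => ?_
  have h1 : 0 ≤ 1 - p := by linarith
  by_cases hP : P G
  · rw [if_pos hP, if_pos (h G hP)]
  · rw [if_neg hP]
    split_ifs <;> positivity

lemma grProb_nonneg (hp0 : 0 ≤ p) (hp1 : p ≤ 1) (P : SimpleGraph (Fin n) → Prop) :
    0 ≤ grProb n p P := by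
  have h1 : 0 ≤ 1 - p := by linarith
  refine Finset.sum_nonneg fun G _ => ?_
  split_ifs <;> positivity

lemma grProb_or_le (hp0 : 0 ≤ p) (hp1 : p ≤ 1) (P Q : SimpleGraph (Fin n) → Prop) :
    grProb n p (fun G => P G ∨ Q G) ≤ grProb n p P + grProb n p Q := by
  have h1 : 0 ≤ 1 - p := by linarith
  rw [grProb, grProb, grProb, ← Finset.sum_add_distrib]
  refine Finset.sum_le_sum fun G _ => ?_
  have h2 : 0 ≤ p ^ G.edgeSet.ncard * (1 - p) ^ (n.choose 2 - G.edgeSet.ncard) := by positivity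
  by_cases hP : P G <;> by_cases hQ : Q G <;> simp [hP, hQ, h2]

lemma grProb_exists_le (hp0 : 0 ≤ p) (hp1 : p ≤ 1) {ι : Type*} (S : Finset ι)
    (P : ι → SimpleGraph (Fin n) → Prop) :
    grProb n p (fun G => ∃ i ∈ S, P i G) ≤ ∑ i ∈ S, grProb n p (P i) := by
  classical
  induction S using Finset.induction_on with
  | empty => simp [grProb]
  | insert a S ha ih =>
    rw [Finset.sum_insert ha]
    refine le_trans (grProb_mono hp0 hp1 ?_) ((grProb_or_le hp0 hp1 (P a) _).trans
      (add_le_add_right ih _))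
    rintro G ⟨i, hi, hP⟩
    rcases Finset.mem_insert.1 hi with rfl | hi
    · exact Or.inl hP
    · exact Or.inr ⟨i, hi, hP⟩

lemma grProb_superset_le (hp0 : 0 ≤ p) (hp1 : p ≤ 1) (F : Finset (Sym2 (Fin n))) :
    grProb n p (fun G => ∀ e ∈ F, e ∈ G.edgeSet) ≤ p ^ F.card := by
  classical
  have h1 : 0 ≤ 1 - p := by linarith
  let S : Finset (Sym2 (Fin n)) := Finset.univ.filter fun e => ¬ e.IsDiag
  have hS : S.card = n.choose 2 := by
    simpa [Fintype.card_subtype] using Sym2.card_subtype_not_diag (α := Fin n)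
  by_cases hF : F ⊆ S
  swap
  · have : grProb n p (fun G => ∀ e ∈ F, e ∈ G.edgeSet) = 0 := by
      refine Finset.sum_eq_zero fun G _ => if_neg fun hc => hF fun e he => ?_
      simpa [S] using G.not_isDiag_of_mem_edgeSet (hc e he)
    rw [this]
    positivity
  have key : ∑ T ∈ (S \ F).powerset, p ^ (F.card + T.card) * (1 - p) ^ ((S \ F).card - T.card)
      = p ^ F.card := by
    simp_rw [pow_add, mul_assoc]
    rw [← Finset.mul_sum, Finset.sum_pow_mul_eq_add_pow]
    simp
  have hgr : grProb n p (fun G => ∀ e ∈ F, e ∈ G.edgeSet) =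
      ∑ G : SimpleGraph (Fin n) with ∀ e ∈ F, e ∈ G.edgeSet,
        p ^ G.edgeSet.ncard * (1 - p) ^ (n.choose 2 - G.edgeSet.ncard) := by
    rw [Finset.sum_filter, grProb]
    congr!
  rw [← key, hgr]
  let φ : SimpleGraph (Fin n) → Finset (Sym2 (Fin n)) := fun G => G.edgeSet.toFinset \ F
  have hcard : ∀ G : SimpleGraph (Fin n), (∀ e ∈ F, e ∈ G.edgeSet) →
      G.edgeSet.ncard = F.card + (φ G).card := by
    intro G hG
    rw [Set.ncard_eq_toFinset_card', add_comm, Finset.card_sdiff_add_card_eq_card]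
    intro e he
    simpa using hG e he
  have hinj : Set.InjOn φ (Finset.univ.filter fun G : SimpleGraph (Fin n) =>
      ∀ e ∈ F, e ∈ G.edgeSet) := by
    intro G hG G' hG' hφ
    simp only [Finset.coe_filter, Finset.mem_univ, true_and, Set.mem_ofPred_eq] at hG hG'
    refine SimpleGraph.edgeSet_inj.1 (Set.ext fun e => ?_)
    by_cases he : e ∈ F
    · exact ⟨fun _ => hG' e he, fun _ => hG e he⟩
    · have := Finset.ext_iff.1 hφ e
      simpa [φ, he] using this
  rw [Finset.sum_congr rfl (g := fun G => p ^ (F.card + (φ G).card) *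
    (1 - p) ^ ((S \ F).card - (φ G).card))]
  · rw [← Finset.sum_image (g := φ)
      (f := fun T => p ^ (F.card + T.card) * (1 - p) ^ ((S \ F).card - T.card)) hinj]
    refine Finset.sum_le_sum_of_subset_of_nonneg ?_ fun _ _ _ => by positivity
    intro T hT
    obtain ⟨G, -, rfl⟩ := Finset.mem_image.1 hT
    refine Finset.mem_powerset.2 (Finset.sdiff_subset_sdiff (fun e he => ?_) le_rfl)
    simpa [S] using G.not_isDiag_of_mem_edgeSet (by simpa using he)
  · intro G hG
    have hG' := (Finset.mem_filter.1 hG).2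
    rw [hcard G hG', Finset.card_sdiff_of_subset hF, hS, Nat.sub_sub]

end Probability

section Exploration

variable {V : Type} [Fintype V] {n : ℕ} {p : ℝ}

/-- Bounds the probability that an exploration from `F` with active edges `Q` either ends in a core
or lasts for `s` steps. -/
lemma grProb_live_le {H : SimpleGraph V} (hdeg : ∀ x, ∃ y, H.Adj x y) {m ε γ : ℝ}
    (hm0 : 0 < m) (hmH : (H.edgeSet.ncard : ℝ) - 1 = m * (Fintype.card V - 2)) (hε0 : 0 < ε)
    (hε : ∀ J : H.Subgraph, J ≠ ⊤ → d2val J.edgeSet.ncard J.verts.ncard + ε ≤ m)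
    {c β : ℝ} (hc0 : 0 < c) (hc : 2 ^ Fintype.card V * (4 * (2 * c)) ≤ 1 / 4) (hβ : 0 ≤ β)
    (hβm : β ≤ 1 / m) {L : ℝ} (hn : 1 ≤ n)
    (hL : L ^ Fintype.card V * (n : ℝ) ^ (-(β * ε)) ≤ 1)
    (hp0 : 0 ≤ p) (hp1 : p ≤ 1) (hpc : p ≤ c * (n : ℝ) ^ (-(1 / m))) (s : ℕ) :
    ∀ F Q : Finset (Sym2 (Fin n)), F.Nonempty → Q ⊆ F → -2 * m ≤ excess m F →
      ((coveredVerts F).card : ℝ) + s * Fintype.card V ≤ L →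
      grProb n p (Live H m γ F Q) ≤
        weight (c * (n : ℝ) ^ (-(1 / m))) n (1 / m - β) m F Q *
          ((n : ℝ) ^ (-((1 / m - β) * γ)) +
            (3 / 4) ^ s * (n : ℝ) ^ ((1 / m - β) * (2 * m))) := by
  have hN : (1 : ℝ) ≤ n := by exact_mod_cast hn
  have hN0 : (0 : ℝ) < n := by linarith
  set α := 1 / m - β with hα
  have hα0 : 0 ≤ α := by linarith
  set q := c * (n : ℝ) ^ (-(1 / m)) with hq
  have hq0 : 0 < q := by positivity
  have hw0 : ∀ F Q : Finset (Sym2 (Fin n)), 0 < weight q n α m F Q := by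
    intro F Q; unfold weight; positivity
  have hbase : ∀ (F Q : Finset (Sym2 (Fin n))) (r : ℝ), 0 ≤ α * (excess m F + r) →
      grProb n p (Live H m γ F Q) ≤ weight q n α m F Q * (n : ℝ) ^ (α * r) := by
    intro F Q r hr
    calc grProb n p (Live H m γ F Q) ≤ p ^ F.card :=
          (grProb_mono hp0 hp1 fun G hG => hG.subset).trans (grProb_superset_le hp0 hp1 F)
      _ ≤ q ^ F.card := by gcongr
      _ ≤ q ^ F.card * (2 ^ Q.card * (n : ℝ) ^ (α * (excess m F + r))) := by
          refine le_mul_of_one_le_right (by positivity) ?_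
          exact one_le_mul_of_one_le_of_one_le (one_le_pow₀ (by norm_num))
            (Real.one_le_rpow hN hr)
      _ = _ := by
          rw [weight, mul_add, Real.rpow_add hN0]
          ring
  have hbase_empty : ∀ F : Finset (Sym2 (Fin n)), F.Nonempty →
      grProb n p (Live H m γ F ∅) ≤ weight q n α m F ∅ * (n : ℝ) ^ (-(α * γ)) := by
    intro F hF
    by_cases hγ : γ ≤ excess m F
    · have := hbase F ∅ (-γ) (mul_nonneg hα0 (by linarith))
      rwa [mul_neg] at this
    · have : grProb n p (Live H m γ F ∅) = 0 :=
        Finset.sum_eq_zero fun G _ => if_neg fun hc => hγ (hc.le_excess hF)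
      rw [this]
      have := hw0 F ∅
      positivity
  induction s with
  | zero =>
    intro F Q hF _ hexc _
    refine (hbase F Q (2 * m) (mul_nonneg hα0 (by linarith))).trans ?_
    have := hw0 F Q
    gcongr
    rw [pow_zero, one_mul]
    exact le_add_of_nonneg_left (by positivity)
  | succ s ih =>
    intro F Q hF hQF hexc hFL
    rcases Q.eq_empty_or_nonempty with rfl | ⟨e, he⟩
    · refine (hbase_empty F hF).trans ?_
      have := hw0 F ∅
      gcongr
      exact le_add_of_nonneg_right (by positivity)
    · classical
      have heF := hQF he
      push_cast at hFL
      set Z := (n : ℝ) ^ (-(α * γ)) + (3 / 4) ^ s * (n : ℝ) ^ (α * (2 * m)) with hZ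
      have hZ0 : 0 < Z := by positivity
      set S := Finset.univ.filter fun h : V ↪ Fin n => e ∈ copyEdges H h ∧ ¬ copyEdges H h ⊆ F
        with hS
      have hpop : grProb n p (Live H m γ F (Q.erase e)) ≤ 1 / 2 * weight q n α m F Q * Z := by
        refine (ih F (Q.erase e) hF ((Finset.erase_subset _ _).trans hQF) hexc
          (by nlinarith [(Nat.cast_nonneg (Fintype.card V) : (0 : ℝ) ≤ _)])).trans ?_
        have : weight q n α m F (Q.erase e) = 1 / 2 * weight q n α m F Q := by
          rw [weight, weight, ← Finset.card_erase_add_one he, pow_succ]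
          ring
        rw [this]
      have hattach : ∀ h ∈ S, grProb n p (Live H m γ (F ∪ copyEdges H h)
          (Q ∪ (copyEdges H h \ F))) ≤
          weight q n α m (F ∪ copyEdges H h) (Q ∪ (copyEdges H h \ F)) * Z := by
        intro h hh
        obtain ⟨-, heh, hnot⟩ := Finset.mem_filter.1 hh
        refine ih _ _ (hF.mono Finset.subset_union_left) (Finset.union_subset_union hQF
          Finset.sdiff_subset) ?_ ?_
        · have h1 := excess_gain hmH hε0 hε heh heF hnot
          have h2 : (0 : ℝ) ≤ if (oldVerts F h).card ≤ 2 then 0 else ε := by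
            split_ifs <;> linarith
          rw [excess_union hdeg]
          linarith
        · have h1 := card_coveredVerts_union hdeg F h
          have h2 : ((coveredVerts (F ∪ copyEdges H h)).card : ℝ) ≤
              (coveredVerts F).card + Fintype.card V := by exact_mod_cast (by omega)
          linarith
      calc grProb n p (Live H m γ F Q)
          ≤ grProb n p (Live H m γ F (Q.erase e)) + ∑ h ∈ S, grProb n p
              (Live H m γ (F ∪ copyEdges H h) (Q ∪ (copyEdges H h \ F))) := by
            refine le_trans (grProb_mono hp0 hp1 ?_) ((grProb_or_le hp0 hp1 _ _).trans
              (add_le_add_right (grProb_exists_le hp0 hp1 S _) _))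
            intro G hG
            rcases hG.step e with h | ⟨h, h1, h2⟩
            · exact Or.inl h
            · exact Or.inr ⟨h, by simp [hS, h1], h2⟩
        _ ≤ 1 / 2 * weight q n α m F Q * Z + ∑ h ∈ S,
              weight q n α m (F ∪ copyEdges H h) (Q ∪ (copyEdges H h \ F)) * Z :=
            add_le_add hpop (Finset.sum_le_sum hattach)
        _ ≤ 1 / 2 * weight q n α m F Q * Z + 1 / 4 * weight q n α m F Q * Z := by
            rw [← Finset.sum_mul]
            have := sum_weight_union_le (Q := Q) hdeg hm0 hmH hε0 hε hc0 hc hβ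
              (by simpa using hL) heF (by nlinarith [(Nat.cast_nonneg (Fintype.card V) : (0 : ℝ) ≤ _),
                (Nat.cast_nonneg s : (0 : ℝ) ≤ _)])
            rw [Fintype.card_fin] at this
            gcongr
        _ = weight q n α m F Q * (3 / 4 * Z) := by ring
        _ ≤ _ := by
            have := hw0 F Q
            gcongr
            rw [hZ, mul_add, pow_succ]
            have : 0 ≤ (n : ℝ) ^ (-(α * γ)) := by positivity
            linarith

end Exploration

section Limit

variable {V : Type} [Fintype V]

lemma StrictlyTwoBalanced.twoDensity_eq {H : SimpleGraph V} (hbal : StrictlyTwoBalanced H) :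
    twoDensity H = d2val H.edgeSet.ncard (Fintype.card V) := by
  have htop : d2val (⊤ : H.Subgraph).edgeSet.ncard (⊤ : H.Subgraph).verts.ncard =
      d2val H.edgeSet.ncard (Fintype.card V) := by
    simp [Set.ncard_univ]
  refine le_antisymm (csSup_le ⟨_, ⊤, rfl⟩ ?_) (htop ▸ d2val_le_twoDensity _)
  rintro x ⟨J, rfl⟩
  by_cases hJ : J = ⊤
  · rw [hJ, htop]
  · simpa using (hbal J hJ).le

lemma StrictlyTwoBalanced.exists_gap {H : SimpleGraph V} (hbal : StrictlyTwoBalanced H) :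
    ∃ ε > 0, ∀ J : H.Subgraph, J ≠ ⊤ →
      d2val J.edgeSet.ncard J.verts.ncard + ε ≤ twoDensity H := by
  classical
  have : Nonempty H.Subgraph := ⟨⊤⟩
  obtain ⟨J₀, hJ₀⟩ := Finite.exists_min fun J : H.Subgraph =>
    if J = ⊤ then 1 else twoDensity H - d2val J.edgeSet.ncard J.verts.ncard
  refine ⟨if J₀ = ⊤ then 1 else twoDensity H - d2val J₀.edgeSet.ncard J₀.verts.ncard, ?_,
    fun J hJ => ?_⟩
  · split_ifs with h
    · norm_num
    · have := hbal J₀ h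
      rw [hbal.twoDensity_eq, ← Nat.card_eq_fintype_card]
      linarith
  · have := hJ₀ J
    rw [if_neg hJ] at this
    linarith

lemma excess_singleton {W : Type} [Fintype W] [DecidableEq W] (m : ℝ) {e : Sym2 W}
    (he : ¬ e.IsDiag) : (coveredVerts {e}).card = 2 ∧ excess m {e} = 1 - 2 * m := by
  have : (coveredVerts {e}).card = 2 := by
    rw [← Sym2.card_toFinset_of_not_isDiag _ he]
    congr 1
    ext v
    simp [coveredVerts]
  refine ⟨this, ?_⟩
  rw [excess, this]
  simp
  ring

lemma grProb_antiRamsey_le {H : SimpleGraph V} (hdeg : ∀ x, ∃ y, H.Adj x y)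
    (hedge : H.edgeSet.Nonempty) (hm1 : 1 < twoDensity H)
    (hm2 : twoDensity H <
      ((minDeg H : ℝ) * ((minDeg H : ℝ) + 1)) / (2 * (minDeg H : ℝ) + 1))
    (hmH : (H.edgeSet.ncard : ℝ) - 1 = twoDensity H * (Fintype.card V - 2)) {ε γ : ℝ}
    (hγ : γ = ((minDeg H : ℝ) * ((minDeg H : ℝ) + 1)) / (2 * (minDeg H : ℝ) + 1) - twoDensity H)
    (hε0 : 0 < ε)
    (hε : ∀ J : H.Subgraph, J ≠ ⊤ → d2val J.edgeSet.ncard J.verts.ncard + ε ≤ twoDensity H)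
    {c β : ℝ} (hc0 : 0 < c) (hc : 2 ^ Fintype.card V * (4 * (2 * c)) ≤ 1 / 4) (hβ : 0 ≤ β)
    (hβm : β ≤ 1 / twoDensity H) {n : ℕ} {p : ℝ} (hn : 1 ≤ n) (s : ℕ)
    (hL : (2 + (s : ℝ) * Fintype.card V) ^ Fintype.card V * (n : ℝ) ^ (-(β * ε)) ≤ 1)
    (hp0 : 0 ≤ p) (hp1 : p ≤ 1) (hpc : p ≤ c * (n : ℝ) ^ (-(1 / twoDensity H))) :
    grProb n p (fun G => AntiRamsey G H) ≤ 2 * c *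
      ((n : ℝ) ^ (β * (2 * twoDensity H - 1 + γ) - γ / twoDensity H) +
        (3 / 4) ^ s * (n : ℝ) ^ (2 - β)) := by
  classical
  set m := twoDensity H with hm
  have hm0 : 0 < m := by linarith
  have hN : (1 : ℝ) ≤ n := by exact_mod_cast hn
  have hN0 : (0 : ℝ) < n := by linarith
  let S : Finset (Sym2 (Fin n)) := Finset.univ.filter fun e => ¬ e.IsDiag
  have hS : (S.card : ℝ) ≤ (n : ℝ) ^ (2 : ℝ) := by
    have h1 : S.card = n.choose 2 := by
      simpa [Fintype.card_subtype] using Sym2.card_subtype_not_diag (α := Fin n)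
    rw [h1, Real.rpow_two]
    exact_mod_cast Nat.choose_le_pow n 2
  set Z := (n : ℝ) ^ (-((1 / m - β) * γ)) + (3 / 4) ^ s * (n : ℝ) ^ ((1 / m - β) * (2 * m)) with hZ
  have hZ0 : 0 < Z := by positivity
  have hsingle : ∀ e ∈ S, grProb n p (Live H m γ {e} {e}) ≤
      c * (n : ℝ) ^ (-(1 / m)) * 2 * (n : ℝ) ^ ((1 / m - β) * (1 - 2 * m)) * Z := by
    intro e he
    obtain ⟨h1, h2⟩ := excess_singleton m (Finset.mem_filter.1 he).2
    refine (grProb_live_le hdeg hm0 hmH hε0 hε hc0 hc hβ hβm hn hL hp0 hp1 hpc s {e} {e}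
      (Finset.singleton_nonempty e) le_rfl (by rw [h2]; linarith) (by rw [h1]; simp)).trans
      (le_of_eq ?_)
    rw [weight, h2, Finset.card_singleton, pow_one, pow_one]
  calc grProb n p (fun G => AntiRamsey G H)
      ≤ ∑ e ∈ S, grProb n p (Live H m γ {e} {e}) := by
        refine le_trans (grProb_mono hp0 hp1 ?_) (grProb_exists_le hp0 hp1 S _)
        intro G hG
        obtain ⟨E, hEG, hE⟩ := hG.exists_core hm1 hm2 hedge
        rw [← hm, ← hγ] at hE
        obtain ⟨e, he, hl⟩ := hE.live hEG
        exact ⟨e, by simpa [S] using he, hl⟩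
    _ ≤ (n : ℝ) ^ (2 : ℝ) *
        (c * (n : ℝ) ^ (-(1 / m)) * 2 * (n : ℝ) ^ ((1 / m - β) * (1 - 2 * m)) * Z) := by
        refine (Finset.sum_le_card_nsmul _ _ _ hsingle).trans ?_
        rw [nsmul_eq_mul]
        gcongr
    _ = 2 * c * ((n : ℝ) ^ (2 : ℝ) * (n : ℝ) ^ (-(1 / m)) *
          (n : ℝ) ^ ((1 / m - β) * (1 - 2 * m)) * Z) := by ring
    _ = _ := by
        have e1 : (n : ℝ) ^ (2 : ℝ) * (n : ℝ) ^ (-(1 / m)) * (n : ℝ) ^ ((1 / m - β) * (1 - 2 * m)) *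
            (n : ℝ) ^ (-((1 / m - β) * γ)) = (n : ℝ) ^ (β * (2 * m - 1 + γ) - γ / m) := by
          rw [← Real.rpow_add hN0, ← Real.rpow_add hN0, ← Real.rpow_add hN0]
          congr 1
          field_simp
          ring
        have e2 : (n : ℝ) ^ (2 : ℝ) * (n : ℝ) ^ (-(1 / m)) * (n : ℝ) ^ ((1 / m - β) * (1 - 2 * m)) *
            (n : ℝ) ^ ((1 / m - β) * (2 * m)) = (n : ℝ) ^ (2 - β) := by
          rw [← Real.rpow_add hN0, ← Real.rpow_add hN0, ← Real.rpow_add hN0]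
          congr 1
          field_simp
          ring
        rw [hZ, ← e1, ← e2]
        ring

lemma eventually_polylog_le {κ B : ℝ} (hκ : 0 < κ) {k : ℕ} (hk : k ≠ 0) :
    ∀ᶠ n : ℕ in atTop,
      (2 + (⌈B * Real.log n⌉₊ : ℝ) * k) ^ k * (n : ℝ) ^ (-κ) ≤ 1 := by
  have hk0 : (0 : ℝ) < k := by exact_mod_cast Nat.pos_of_ne_zero hk
  have hδ : 0 < κ / k := by positivity
  have h1 : Tendsto (fun x : ℝ => (2 + k) * x ^ (-(κ / k)) +
      |B| * k * (Real.log x * x ^ (-(κ / k)))) atTop (nhds 0) := by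
    have ha := (tendsto_rpow_neg_atTop hδ).const_mul ((2 : ℝ) + k)
    have hb : Tendsto (fun x : ℝ => Real.log x * x ^ (-(κ / k))) atTop (nhds 0) := by
      refine ((isLittleO_log_rpow_atTop hδ).tendsto_div_nhds_zero).congr' ?_
      filter_upwards [eventually_gt_atTop 0] with x hx
      rw [Real.rpow_neg hx.le, div_eq_mul_inv]
    simpa using ha.add (hb.const_mul (|B| * k))
  filter_upwards [(h1.comp tendsto_natCast_atTop_atTop).eventually_le_const zero_lt_one,
    eventually_ge_atTop 1] with n hn hn1
  have hN : (1 : ℝ) ≤ n := by exact_mod_cast hn1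
  have hlog : 0 ≤ Real.log n := Real.log_nonneg hN
  have hceil : (⌈B * Real.log n⌉₊ : ℝ) ≤ |B| * Real.log n + 1 := by
    refine le_trans ?_ (Nat.ceil_lt_add_one (by positivity)).le
    exact_mod_cast Nat.ceil_mono (mul_le_mul_of_nonneg_right (le_abs_self B) hlog)
  have hpow : (n : ℝ) ^ (-κ) = ((n : ℝ) ^ (-(κ / k))) ^ k := by
    rw [← Real.rpow_natCast, ← Real.rpow_mul (by positivity)]
    congr 1
    field_simp
  rw [hpow, ← mul_pow]
  refine pow_le_one₀ (by positivity) (le_trans ?_ hn)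
  have hx : 0 ≤ (n : ℝ) ^ (-(κ / k)) := by positivity
  calc _ ≤ (2 + (|B| * Real.log n + 1) * k) * (n : ℝ) ^ (-(κ / k)) := by gcongr
    _ = _ := by simp only [Function.comp]; ring

lemma three_quarters_pow_ceil_le {K : ℝ} {n : ℕ} (hn : 1 ≤ n) :
    (3 / 4 : ℝ) ^ ⌈K / Real.log (4 / 3) * Real.log n⌉₊ ≤ (n : ℝ) ^ (-K) := by
  have hN : (0 : ℝ) < n := by exact_mod_cast hn
  have hlog : 0 < Real.log (4 / 3) := Real.log_pos (by norm_num)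
  have h34 : Real.log (3 / 4) = -Real.log (4 / 3) := by
    rw [← Real.log_inv]; norm_num
  rw [← Real.rpow_natCast, Real.rpow_def_of_pos (by norm_num), Real.rpow_def_of_pos hN, h34]
  refine Real.exp_le_exp.2 ?_
  have := mul_le_mul_of_nonneg_left (Nat.le_ceil (K / Real.log (4 / 3) * Real.log n)) hlog.le
  have h2 : Real.log (4 / 3) * (K / Real.log (4 / 3) * Real.log n) = K * Real.log n := by
    field_simp
  linarith

end Limit

/-- the anti-Ramsey 0-statement for sparse strictly 2-balanced graphs. -/
theorem stmt_8 {V : Type} [Fintype V] (H : SimpleGraph V)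
    (hbal : StrictlyTwoBalanced H) (hm1 : 1 < twoDensity H)
    (hm2 : twoDensity H <
      ((minDeg H : ℝ) * ((minDeg H : ℝ) + 1)) / (2 * (minDeg H : ℝ) + 1)) :
    ∃ c : ℝ, 0 < c ∧ ∀ p : ℕ → ℝ, (∀ n, 0 ≤ p n ∧ p n ≤ 1) →
      (∀ n : ℕ, p n ≤ c * (n : ℝ) ^ (-(1 / twoDensity H))) →
      Tendsto (fun n => grProb n (p n) (fun G => AntiRamsey G H)) atTop (nhds 0) := by
  obtain ⟨ε, hε0, hε⟩ := hbal.exists_gap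
  have hd2 := hbal.twoDensity_eq
  have hcond : 1 ≤ H.edgeSet.ncard ∧ 3 ≤ Fintype.card V := by
    by_contra hc
    rw [hd2, d2val, if_neg hc] at hm1
    split_ifs at hm1 <;> norm_num at hm1
  rw [d2val, if_pos hcond] at hd2
  have hmH : (H.edgeSet.ncard : ℝ) - 1 = twoDensity H * (Fintype.card V - 2) := by
    have : (3 : ℝ) ≤ Fintype.card V := by exact_mod_cast hcond.2
    rw [hd2, div_mul_cancel₀ _ (by linarith)]
  have hedge : H.edgeSet.Nonempty := Set.nonempty_of_ncard_ne_zero (by omega)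
  have hdeg : ∀ x, ∃ y, H.Adj x y := by
    intro x
    have h1 : minDeg H ≠ 0 := by
      intro h0
      have := hm1.trans hm2
      rw [h0] at this
      norm_num at this
    have h2 : minDeg H ≤ (H.neighborSet x).ncard := Nat.sInf_le ⟨x, rfl⟩
    exact Set.nonempty_of_ncard_ne_zero (s := H.neighborSet x) (by omega)
  set m := twoDensity H with hm
  have hm0 : 0 < m := by linarith
  obtain ⟨γ, hγ⟩ : ∃ γ, γ =
    ((minDeg H : ℝ) * ((minDeg H : ℝ) + 1)) / (2 * (minDeg H : ℝ) + 1) - m := ⟨_, rfl⟩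
  have hγ0 : 0 < γ := by linarith
  have hden : 0 < 2 * m - 1 + γ := by linarith
  obtain ⟨β, hβ⟩ : ∃ β, β = γ / (2 * m * (2 * m - 1 + γ)) := ⟨_, rfl⟩
  have hβ0 : 0 < β := by rw [hβ]; positivity
  have hβm : β ≤ 1 / m := by
    rw [hβ, div_le_div_iff₀ (by positivity) hm0]
    nlinarith
  have hexp : β * (2 * m - 1 + γ) - γ / m = -(γ / (2 * m)) := by
    rw [hβ]
    field_simp
    ring
  obtain ⟨c, hc⟩ : ∃ c : ℝ, c = 1 / (32 * 2 ^ Fintype.card V) := ⟨_, rfl⟩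
  have hc0 : 0 < c := by rw [hc]; positivity
  refine ⟨c, hc0, fun p hp hpc => ?_⟩
  have hlim : Tendsto (fun n : ℕ => 2 * c * ((n : ℝ) ^ (-(γ / (2 * m))) + (n : ℝ) ^ (-(1 : ℝ))))
      atTop (nhds 0) := by
    have h1 := ((tendsto_rpow_neg_atTop (show 0 < γ / (2 * m) by positivity)).add
      (tendsto_rpow_neg_atTop one_pos)).const_mul (2 * c)
    simpa [Function.comp_def] using h1.comp (tendsto_natCast_atTop_atTop (R := ℝ))
  refine tendsto_of_tendsto_of_tendsto_of_le_of_le' tendsto_const_nhds hlim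
    (Eventually.of_forall fun n => grProb_nonneg (hp n).1 (hp n).2 _) ?_
  filter_upwards [eventually_ge_atTop 1,
    eventually_polylog_le (B := 3 / Real.log (4 / 3)) (mul_pos hβ0 hε0)
      (show Fintype.card V ≠ 0 by omega)] with n hn hL
  have hN : (1 : ℝ) ≤ n := by exact_mod_cast hn
  have hcsmall : 2 ^ Fintype.card V * (4 * (2 * c)) ≤ 1 / 4 := by
    rw [hc]
    refine le_of_eq ?_
    field_simp
    norm_num
  refine (grProb_antiRamsey_le hdeg hedge hm1 hm2 hmH hγ hε0 hε hc0 hcsmall hβ0.le hβm hn _ hL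
    (hp n).1 (hp n).2 (hpc n)).trans ?_
  rw [← hm, hexp]
  gcongr
  calc (3 / 4 : ℝ) ^ ⌈3 / Real.log (4 / 3) * Real.log n⌉₊ * (n : ℝ) ^ (2 - β)
      ≤ (n : ℝ) ^ (-(3 : ℝ)) * (n : ℝ) ^ (2 - β) := by
        gcongr
        exact three_quarters_pow_ceil_le hn
    _ = (n : ℝ) ^ (-1 - β) := by
        rw [← Real.rpow_add (by linarith)]
        congr 1
        ring
    _ ≤ _ := Real.rpow_le_rpow_of_exponent_le hN (by linarith)
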